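/- Let (X,d,φ) be an irreducible Smale space with topological entropy h(φ), and ℛ₁ a Markov partition of X with diam(R) ≤ ε''_X for every R ∈ ℛ₁, giving rise to the refining sequence (ℛ_n)_{n≥0} of Markov partitions. Then there exist constants C, c > 0 such that for every ε ∈ (0,1) there is n₀ ∈ ℕ with: for every n ≥ n₀, c·e^{2(h(φ)−ε)n} < #ℛ_n < C·e^{2(h(φ)+ε)n}. -/

import Mathlib

open Set Metric MeasureTheory Topology
open scoped ENNReal NNReal

/-- A dynamical system is irreducible if for every ordered pair of nonempty open
sets `U, V` there is `n : ℕ` with `ψ^[n] '' U ∩ V ≠ ∅`. -/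
def IrreducibleSystem {Z : Type*} [TopologicalSpace Z] (ψ : Z → Z) : Prop :=
  ∀ U V : Set Z, IsOpen U → IsOpen V → U.Nonempty → V.Nonempty →
    ∃ n : ℕ, (ψ^[n] '' U ∩ V).Nonempty

/-- A dynamical system is mixing if for every ordered pair of nonempty open sets
`U, V` there is `N : ℕ` with `ψ^[n] '' U ∩ V ≠ ∅` for all `n ≥ N`. -/
def MixingSystem {Z : Type*} [TopologicalSpace Z] (ψ : Z → Z) : Prop :=
  ∀ U V : Set Z, IsOpen U → IsOpen V → U.Nonempty → V.Nonempty →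
    ∃ N : ℕ, ∀ n ≥ N, (ψ^[n] '' U ∩ V).Nonempty

/-- The (possibly infinite) Lipschitz constant of a map between metric spaces. -/
noncomputable def lipConst {X : Type*} [PseudoEMetricSpace X] (f : X → X) : ℝ≥0∞ :=
  sInf {K : ℝ≥0∞ | ∀ x y : X, edist (f x) (f y) ≤ K * edist x y}

/-- A measure on a metric space is Ahlfors `s`-regular if closed balls of radius
`r < diam Z` have measure comparable to `r ^ s`. -/
def AhlforsRegular {Z : Type*} [MetricSpace Z] [MeasurableSpace Z]
    (μ : Measure Z) (s : ℝ) : Prop :=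
  0 < s ∧ ∃ C : ℝ, 0 < C ∧ ∀ (z : Z) (r : ℝ), 0 ≤ r → r < diam (Set.univ : Set Z) →
    ENNReal.ofReal (C⁻¹ * r ^ s) ≤ μ (closedBall z r) ∧
    μ (closedBall z r) ≤ ENNReal.ofReal (C * r ^ s)

/-- A Smale space: a compact metric space together with a homeomorphism `phi`,
constants `eps > 0`, `lam > 1` and a partially defined continuous bracket map
satisfying the bracket axioms and the contraction axioms. -/
structure SmaleSpace (X : Type*) [MetricSpace X] where
  phi : Equiv.Perm X
  phi_cont : Continuous phi
  phi_symm_cont : Continuous phi.symm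
  eps : ℝ
  lam : ℝ
  eps_pos : 0 < eps
  one_lt_lam : 1 < lam
  bracket : X → X → X
  bracket_cont : ContinuousOn (fun p : X × X => bracket p.1 p.2)
    {p : X × X | dist p.1 p.2 ≤ eps}
  bracket_self : ∀ x : X, bracket x x = x
  bracket_assoc₁ : ∀ x y z : X, dist y z ≤ eps → dist x (bracket y z) ≤ eps →
    dist x z ≤ eps → bracket x (bracket y z) = bracket x z
  bracket_assoc₂ : ∀ x y z : X, dist x y ≤ eps → dist (bracket x y) z ≤ eps →
    dist x z ≤ eps → bracket (bracket x y) z = bracket x z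
  bracket_phi : ∀ x y : X, dist x y ≤ eps → dist (phi x) (phi y) ≤ eps →
    phi (bracket x y) = bracket (phi x) (phi y)
  contract_s : ∀ (x : X) (ε : ℝ), 0 < ε → ε ≤ eps → ∀ y z : X,
    dist x y < ε → bracket x y = y → dist x z < ε → bracket x z = z →
    dist (phi y) (phi z) ≤ lam⁻¹ * dist y z
  contract_u : ∀ (x : X) (ε : ℝ), 0 < ε → ε ≤ eps → ∀ y z : X,
    dist x y < ε → bracket y x = y → dist x z < ε → bracket z x = z →
    dist (phi.symm y) (phi.symm z) ≤ lam⁻¹ * dist y z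

namespace SmaleSpace

variable {X : Type*} [MetricSpace X] (S : SmaleSpace X)

/-- The local stable set `X^s(x, ε)`. -/
def stable (x : X) (ε : ℝ) : Set X := {y | dist x y < ε ∧ S.bracket x y = y}

/-- The local unstable set `X^u(x, ε)`. -/
def unstable (x : X) (ε : ℝ) : Set X := {y | dist x y < ε ∧ S.bracket y x = y}

/-- A rectangle (relative to the constant `ε'`): a nonempty set of diameter at
most `ε'` closed under the bracket. -/
def IsRectangle (ε' : ℝ) (R : Set X) : Prop :=
  R.Nonempty ∧ diam R ≤ ε' ∧ ∀ x ∈ R, ∀ y ∈ R, S.bracket x y ∈ R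

/-- A proper rectangle: a closed rectangle equal to the closure of its interior. -/
def IsProperRectangle (ε' : ℝ) (R : Set X) : Prop :=
  S.IsRectangle ε' R ∧ IsClosed R ∧ R = closure (interior R)

/-- `X^s(x, R) = X^s(x, 2ε') ∩ R`. -/
def stableIn (ε' : ℝ) (x : X) (R : Set X) : Set X := S.stable x (2 * ε') ∩ R

/-- `X^u(x, R) = X^u(x, 2ε') ∩ R`. -/
def unstableIn (ε' : ℝ) (x : X) (R : Set X) : Set X := S.unstable x (2 * ε') ∩ R

/-- A Markov partition: a finite cover by nonempty proper rectangles with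
pairwise disjoint interiors, satisfying the Markov conditions. -/
def IsMarkovPartition (ε' : ℝ) (P : Set (Set X)) : Prop :=
  P.Finite ∧ ⋃₀ P = Set.univ ∧
  (∀ R ∈ P, S.IsProperRectangle ε' R) ∧
  (∀ R ∈ P, ∀ R' ∈ P, R ≠ R' → interior R ∩ interior R' = ∅) ∧
  (∀ R ∈ P, ∀ R' ∈ P, ∀ x : X, x ∈ interior R → S.phi x ∈ interior R' →
    S.unstableIn ε' (S.phi x) R' ⊆ S.phi '' (S.unstableIn ε' x R) ∧
    S.phi '' (S.stableIn ε' x R) ⊆ S.stableIn ε' (S.phi x) R')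

/-- The refining sequence of Markov partitions
`ℛ_n = {⋂_{i=1-n}^{n-1} φ^{-i}(R_{x_i}) : R_{x_i} ∈ ℛ₁, int ≠ ∅}`, with
`ℛ₀ = {X}`. -/
def markovSeq (P : Set (Set X)) : ℕ → Set (Set X)
  | 0 => {Set.univ}
  | (n + 1) => {R | (interior R).Nonempty ∧ ∃ g : ℤ → Set X, (∀ i : ℤ, g i ∈ P) ∧
      R = ⋂ i ∈ Finset.Icc (-(n : ℤ)) (n : ℤ), (⇑(S.phi ^ i)) ⁻¹' (g i)}

end SmaleSpace

/-- `N_𝒰(Y)`: the elements of the cover `𝒰` meeting the set `Y`. -/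
def nbr {X : Type*} (U : Set (Set X)) (Y : Set X) : Set (Set X) :=
  {u ∈ U | (u ∩ Y).Nonempty}

/-- The property defining the constant `ε'_X` of a Smale space. -/
def SmaleSpace.epsOne {X : Type*} [MetricSpace X] (S : SmaleSpace X) (ε' : ℝ) : Prop :=
  0 < ε' ∧ ε' ≤ S.eps / 2 ∧ ∀ x y : X, dist x y ≤ ε' →
    dist x (S.bracket x y) < S.eps / 2 ∧ dist y (S.bracket x y) < S.eps / 2

/-- The property defining the constant `ε''_X` of a Smale space. -/
def SmaleSpace.epsTwo {X : Type*} [MetricSpace X] (S : SmaleSpace X) (ε' ε'' : ℝ) : Prop :=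
  0 < ε'' ∧ ε'' < ε' / 12 ∧ ∀ x y : X, dist x y ≤ ε'' →
    (∀ i : ℤ, |i| ≤ 2 → dist ((S.phi ^ i) x) ((S.phi ^ i) y) ≤ ε' / 2) ∧
    dist (S.bracket x y) x ≤ ε' / 4 ∧ dist (S.bracket x y) y ≤ ε' / 4


namespace SmaleSpace

variable {X : Type*} [MetricSpace X] (S : SmaleSpace X)

theorem continuous_zpow_phi (i : ℤ) : Continuous ⇑(S.phi ^ i) := by
  have hn : ∀ n : ℕ, Continuous ⇑(S.phi ^ n) := by
    intro n
    rw [← Equiv.Perm.iterate_eq_pow]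
    exact S.phi_cont.iterate n
  have hn' : ∀ n : ℕ, Continuous ⇑(S.phi⁻¹ ^ n) := by
    intro n
    rw [← Equiv.Perm.iterate_eq_pow]
    exact S.phi_symm_cont.iterate n
  obtain ⟨n, rfl | rfl⟩ := Int.eq_nat_or_neg i
  · simpa using hn n
  · simpa using hn' n

theorem mem_interior_zpow (i : ℤ) (A : Set X) (x : X)
    (hx : x ∈ interior ((⇑(S.phi ^ i)) ⁻¹' A)) : (S.phi ^ i) x ∈ interior A := by
  let e : X ≃ₜ X :=
    { toEquiv := S.phi ^ i
      continuous_toFun := S.continuous_zpow_phi i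
      continuous_invFun := by
        have := S.continuous_zpow_phi (-i)
        rw [zpow_neg] at this
        exact this }
  have h := e.preimage_interior A
  have hx' : x ∈ interior (e ⁻¹' A) := hx
  rw [← h] at hx'
  exact hx'

theorem zpow_add_apply (i j : ℤ) (x : X) :
    (S.phi ^ i) ((S.phi ^ j) x) = (S.phi ^ (i + j)) x := by
  rw [zpow_add]; rfl

theorem iterate_apply_zpow (j : ℕ) (i : ℤ) (x : X) :
    (⇑S.phi)^[j] ((S.phi ^ i) x) = (S.phi ^ ((j : ℤ) + i)) x := by
  rw [Equiv.Perm.iterate_eq_pow, zpow_add]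
  simp

theorem phi_zpow (i : ℤ) (x : X) : S.phi ((S.phi ^ i) x) = (S.phi ^ (i + 1)) x := by
  rw [add_comm, zpow_add]; rfl

variable {S}

/-- expansiveness -/
theorem expansive {ε' ε'' : ℝ} (hε' : S.epsOne ε') (hε'' : S.epsTwo ε' ε'') (x y : X)
    (hxy : ∀ i : ℤ, dist ((S.phi ^ i) x) ((S.phi ^ i) y) ≤ ε'') : x = y := by
  obtain ⟨h1, h2, h3⟩ := hε'
  obtain ⟨k1, k2, k3⟩ := hε''
  have hl := S.one_lt_lam
  have he := S.eps_pos
  set w := S.bracket x y with hw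
  have hb : ∀ i : ℤ, (S.phi ^ i) w = S.bracket ((S.phi ^ i) x) ((S.phi ^ i) y) := by
    have step : ∀ i : ℤ, S.phi (S.bracket ((S.phi ^ i) x) ((S.phi ^ i) y)) =
        S.bracket ((S.phi ^ (i + 1)) x) ((S.phi ^ (i + 1)) y) := by
      intro i
      rw [S.bracket_phi, S.phi_zpow, S.phi_zpow]
      · linarith [hxy i]
      · rw [S.phi_zpow, S.phi_zpow]; linarith [hxy (i + 1)]
    intro i
    induction i using Int.induction_on with
    | zero => simp [hw]
    | succ i ih => rw [← S.phi_zpow, ih, step]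
    | pred i ih =>
      apply S.phi.injective
      rw [step, S.phi_zpow]
      simpa using ih
  have hs : ∀ i : ℤ, dist ((S.phi ^ (i + 1)) x) ((S.phi ^ (i + 1)) w) ≤
      S.lam⁻¹ * dist ((S.phi ^ i) x) ((S.phi ^ i) w) := by
    intro i
    have a1 := k3 _ _ (hxy i)
    rw [← S.phi_zpow, ← S.phi_zpow]
    apply S.contract_s ((S.phi ^ i) x) S.eps he le_rfl
    · simpa using he
    · exact S.bracket_self _
    · rw [hb, dist_comm]; linarith [a1.2.1]
    · rw [hb]
      apply S.bracket_assoc₁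
      · linarith [hxy i]
      · rw [dist_comm]; linarith [a1.2.1]
      · linarith [hxy i]
  have hu : ∀ i : ℤ, dist ((S.phi ^ (i - 1)) y) ((S.phi ^ (i - 1)) w) ≤
      S.lam⁻¹ * dist ((S.phi ^ i) y) ((S.phi ^ i) w) := by
    intro i
    have a1 := k3 _ _ (hxy i)
    have e : ∀ z, (S.phi ^ (i - 1)) z = S.phi.symm ((S.phi ^ i) z) := by
      intro z
      rw [Equiv.eq_symm_apply, S.phi_zpow]; simp
    rw [e, e]
    apply S.contract_u ((S.phi ^ i) y) S.eps he le_rfl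
    · simpa using he
    · exact S.bracket_self _
    · rw [hb, dist_comm]; linarith [a1.2.2]
    · rw [hb]
      apply S.bracket_assoc₂
      · linarith [hxy i]
      · linarith [a1.2.2]
      · linarith [hxy i]
  have hlim : ∀ B : ℝ, Filter.Tendsto (fun n : ℕ => S.lam⁻¹ ^ n * B) Filter.atTop (𝓝 0) := by
    intro B
    have := (tendsto_pow_atTop_nhds_zero_of_lt_one (inv_nonneg.2 (by linarith : (0:ℝ) ≤ S.lam))
      (inv_lt_one_of_one_lt₀ hl)).mul_const B
    simpa using this
  have hli : 0 ≤ S.lam⁻¹ := inv_nonneg.2 (by linarith)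
  have e1 : x = w := by
    have hn : ∀ n : ℕ, dist x w ≤ S.lam⁻¹ ^ n *
        dist ((S.phi ^ (-(n : ℤ))) x) ((S.phi ^ (-(n : ℤ))) w) := by
      intro n
      induction n with
      | zero => simp
      | succ n ih =>
        have := hs (-((n + 1 : ℕ) : ℤ))
        have e : (-((n + 1 : ℕ) : ℤ)) + 1 = -(n : ℤ) := by push_cast; ring
        rw [e] at this
        rw [pow_succ, mul_assoc]
        exact ih.trans (mul_le_mul_of_nonneg_left this (pow_nonneg hli n))
    have : dist x w ≤ 0 := by
      refine ge_of_tendsto' (hlim (ε' / 4)) fun n => (hn n).trans ?_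
      refine mul_le_mul_of_nonneg_left ?_ (pow_nonneg hli n)
      rw [hb, dist_comm]
      exact (k3 _ _ (hxy _)).2.1
    exact dist_le_zero.1 this
  have e2 : y = w := by
    have hn : ∀ n : ℕ, dist y w ≤ S.lam⁻¹ ^ n *
        dist ((S.phi ^ (n : ℤ)) y) ((S.phi ^ (n : ℤ)) w) := by
      intro n
      induction n with
      | zero => simp
      | succ n ih =>
        have := hu (((n + 1 : ℕ) : ℤ))
        have e : (((n + 1 : ℕ) : ℤ)) - 1 = (n : ℤ) := by push_cast; ring
        rw [e] at this
        rw [pow_succ, mul_assoc]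
        exact ih.trans (mul_le_mul_of_nonneg_left this (pow_nonneg hli n))
    have : dist y w ≤ 0 := by
      refine ge_of_tendsto' (hlim (ε' / 4)) fun n => (hn n).trans ?_
      refine mul_le_mul_of_nonneg_left ?_ (pow_nonneg hli n)
      rw [hb, dist_comm]
      exact (k3 _ _ (hxy _)).2.2
    exact dist_le_zero.1 this
  rw [e1, ← e2]

theorem expansive_unif [CompactSpace X] {ε' ε'' : ℝ} (hε' : S.epsOne ε')
    (hε'' : S.epsTwo ε' ε'') (U : Set (X × X)) (hU : U ∈ uniformity X) :
    ∃ k : ℕ, ∀ x y : X, (∀ i : ℤ, |i| ≤ k → dist ((S.phi ^ i) x) ((S.phi ^ i) y) ≤ ε'') →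
      (x, y) ∈ U := by
  let V : ℕ → Set (X × X) := fun k =>
    {p | ∀ i : ℤ, |i| ≤ k → dist ((S.phi ^ i) p.1) ((S.phi ^ i) p.2) ≤ ε''}
  have hcl : ∀ k, IsClosed (V k) := by
    intro k
    have : V k = ⋂ i : ℤ, ⋂ _ : |i| ≤ k,
        {p : X × X | dist ((S.phi ^ i) p.1) ((S.phi ^ i) p.2) ≤ ε''} := by
      ext p; simp [V]
    rw [this]
    refine isClosed_iInter fun i => isClosed_iInter fun _ => ?_
    exact isClosed_le (((S.continuous_zpow_phi i).comp continuous_fst).dist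
      ((S.continuous_zpow_phi i).comp continuous_snd)) continuous_const
  have hanti : Antitone V := by
    intro a b hab p hp i hi
    exact hp i (hi.trans (by exact_mod_cast hab))
  obtain ⟨k, hk⟩ := exists_subset_nhds_of_isCompact' (V := V) (U := U) hanti.directed_ge
    (fun k => (hcl k).isCompact) hcl (by
      rintro ⟨x, y⟩ hp
      have : x = y := expansive hε' hε'' x y (by
        intro i
        exact (mem_iInter.1 hp i.natAbs) i (by simp))
      subst this
      exact nhds_le_uniformity x hU)
  exact ⟨k, fun x y hxy => hk (show (x, y) ∈ V k from hxy)⟩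

/-- The core Markov argument. -/
theorem markov_core {ε' ε'' : ℝ} (hε' : S.epsOne ε') (hε'' : S.epsTwo ε' ε'')
    {R1 : Set (Set X)} (hMP : S.IsMarkovPartition ε' R1) (m : ℕ) (A B : ℕ → Set X)
    (hA : ∀ i, A i ∈ R1) (hB : ∀ i, B i ∈ R1) (h0 : A 0 = B 0) (hm : A m = B m) (y z : X)
    (hy : ∀ i ≤ m, S.phi^[i] y ∈ interior (A i)) (hz : ∀ i ≤ m, S.phi^[i] z ∈ interior (B i))
    (hd : ∀ i ≤ m, dist (S.phi^[i] y) (S.phi^[i] z) < ε'') :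
    ∀ i ≤ m, S.phi^[i] (S.bracket y z) ∈ A i ∩ B i := by
  obtain ⟨h1, h2, h3⟩ := hε'
  obtain ⟨k1, k2, k3⟩ := hε''
  obtain ⟨-, -, hR, -, hMk⟩ := hMP
  have he := S.eps_pos
  have hb : ∀ i ≤ m, S.phi^[i] (S.bracket y z) = S.bracket (S.phi^[i] y) (S.phi^[i] z) := by
    intro i
    induction i with
    | zero => simp
    | succ i ih =>
      intro hi
      have d1 := hd i (by omega)
      have d2 := hd (i + 1) hi
      simp only [Function.iterate_succ_apply'] at d2 ⊢
      rw [ih (by omega), S.bracket_phi _ _ (by linarith) (by linarith)]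
  have hsA : ∀ i ≤ m, S.phi^[i] (S.bracket y z) ∈ S.stableIn ε' (S.phi^[i] y) (A i) := by
    intro i
    induction i with
    | zero =>
      intro hi
      have d := hd 0 hi
      have yA := interior_subset (hy 0 hi)
      have zB := interior_subset (hz 0 hi)
      simp only [Function.iterate_zero, id] at d yA zB ⊢
      have a := k3 _ _ d.le
      refine ⟨⟨?_, ?_⟩, ?_⟩
      · rw [dist_comm]; linarith [a.2.1]
      · apply S.bracket_assoc₁
        · linarith
        · rw [dist_comm]; linarith [a.2.1]
        · linarith
      · exact (hR _ (hA 0)).1.2.2 _ yA _ (h0 ▸ zB)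
    | succ i ih =>
      intro hi
      have := hy (i + 1) hi
      simp only [Function.iterate_succ_apply'] at this ⊢
      exact (hMk _ (hA i) _ (hA (i + 1)) _ (hy i (by omega)) this).2
        (mem_image_of_mem _ (ih (by omega)))
  have huB : ∀ j ≤ m, S.phi^[m - j] (S.bracket y z) ∈
      S.unstableIn ε' (S.phi^[m - j] z) (B (m - j)) := by
    intro j
    induction j with
    | zero =>
      intro _
      have d := hd m le_rfl
      have yA := interior_subset (hy m le_rfl)
      have zB := interior_subset (hz m le_rfl)
      rw [Nat.sub_zero, hb m le_rfl]
      have a := k3 _ _ d.le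
      refine ⟨⟨?_, ?_⟩, ?_⟩
      · rw [dist_comm]; linarith [a.2.2]
      · apply S.bracket_assoc₂
        · linarith
        · linarith [a.2.2]
        · linarith
      · exact (hR _ (hB m)).1.2.2 _ (hm ▸ yA) _ zB
    | succ j ih =>
      intro hj
      have ih := ih (by omega)
      obtain ⟨l, hl⟩ : ∃ l, l = m - (j + 1) := ⟨_, rfl⟩
      have hl' : m - j = l + 1 := by omega
      rw [← hl]
      rw [hl'] at ih
      have hz1 := hz (l + 1) (by omega)
      simp only [Function.iterate_succ_apply'] at ih hz1
      obtain ⟨v, hv, hv'⟩ := (hMk _ (hB l) _ (hB (l + 1)) _ (hz l (by omega)) hz1).1 ih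
      rwa [S.phi.injective hv'] at hv
  intro i hi
  refine ⟨(hsA i hi).2, ?_⟩
  have := (huB (m - i) (by omega)).2
  rwa [show m - (m - i) = i by omega] at this

theorem markov_words_eq {ε' ε'' : ℝ} (hε' : S.epsOne ε') (hε'' : S.epsTwo ε' ε'')
    {R1 : Set (Set X)} (hMP : S.IsMarkovPartition ε' R1) (m : ℕ) (A B : ℕ → Set X)
    (hA : ∀ i, A i ∈ R1) (hB : ∀ i, B i ∈ R1) (h0 : A 0 = B 0) (hm : A m = B m) (y z : X)
    (hy : ∀ i ≤ m, S.phi^[i] y ∈ interior (A i)) (hz : ∀ i ≤ m, S.phi^[i] z ∈ interior (B i))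
    (hd : ∀ i ≤ m, dist (S.phi^[i] y) (S.phi^[i] z) < ε'') :
    ∀ i ≤ m, A i = B i := by
  have he := S.eps_pos
  set w := S.bracket y z with hw
  have hyz : dist y z < ε'' := hd 0 (Nat.zero_le _)
  have H1 := hε'
  have H2 := hε''
  obtain ⟨h1, h2, h3⟩ := hε'
  obtain ⟨k1, k2, k3⟩ := hε''
  have a := k3 y z hyz.le
  rw [← hw] at a
  have hwy : S.bracket w y = y := by
    rw [hw, S.bracket_assoc₂, S.bracket_self]
    · linarith
    · linarith [a.2.1]
    · simpa using he.le
  have hzw : S.bracket z w = z := by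
    rw [hw, S.bracket_assoc₁, S.bracket_self]
    · linarith
    · rw [dist_comm]; linarith [a.2.2]
    · simpa using he.le
  have cont : ∀ p q : X, dist p q < S.eps →
      ContinuousAt (fun p : X × X => S.bracket p.1 p.2) (p, q) := by
    intro p q hpq
    apply S.bracket_cont.continuousAt
    have : IsOpen {p : X × X | dist p.1 p.2 < S.eps} := isOpen_lt continuous_dist continuous_const
    exact Filter.mem_of_superset (this.mem_nhds hpq)
      (fun p (hp : dist p.1 p.2 < S.eps) => show dist p.1 p.2 ≤ S.eps from hp.le)
  have c1 : Filter.Tendsto (fun v => S.bracket v y) (𝓝 w) (𝓝 y) := by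
    have h := (cont w y (by linarith [a.2.1])).tendsto
    simp only [hwy] at h
    exact h.comp ((continuous_id.prodMk continuous_const).tendsto' w (w, y) rfl)
  have c2 : Filter.Tendsto (fun v => S.bracket z v) (𝓝 w) (𝓝 z) := by
    have h := (cont z w (by rw [dist_comm]; linarith [a.2.2])).tendsto
    simp only [hzw] at h
    exact h.comp ((continuous_const.prodMk continuous_id).tendsto' w (z, w) rfl)
  have ci : ∀ i, Continuous (S.phi^[i]) := fun i => S.phi_cont.iterate i
  have ev1 : ∀ᶠ v in 𝓝 w, ∀ i ≤ m, S.phi^[i] (S.bracket v y) ∈ interior (A i) := by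
    refine (Set.finite_Iic m).eventually_all.2 fun i hi => ?_
    exact (((ci i).tendsto y).comp c1).eventually (isOpen_interior.mem_nhds (hy i hi))
  have ev2 : ∀ᶠ v in 𝓝 w, ∀ i ≤ m, S.phi^[i] (S.bracket z v) ∈ interior (B i) := by
    refine (Set.finite_Iic m).eventually_all.2 fun i hi => ?_
    exact (((ci i).tendsto z).comp c2).eventually (isOpen_interior.mem_nhds (hz i hi))
  have ev3 : ∀ᶠ v in 𝓝 w, ∀ i ≤ m,
      dist (S.phi^[i] (S.bracket v y)) (S.phi^[i] (S.bracket z v)) < ε'' := by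
    refine (Set.finite_Iic m).eventually_all.2 fun i hi => ?_
    exact ((((ci i).tendsto y).comp c1).dist (((ci i).tendsto z).comp c2)).eventually_lt_const
      (hd i hi)
  have t : Filter.Tendsto (fun v : X => v) (𝓝 w) (𝓝 w) := Filter.tendsto_id
  have ev4 : ∀ᶠ v in 𝓝 w, dist v y < S.eps :=
    (t.dist tendsto_const_nhds).eventually_lt_const (by linarith [a.2.1])
  have ev5 : ∀ᶠ v in 𝓝 w, dist v z < S.eps :=
    (t.dist tendsto_const_nhds).eventually_lt_const (by linarith [a.2.2])
  have ev6 : ∀ᶠ v in 𝓝 w, dist v (S.bracket z v) < S.eps :=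
    (t.dist c2).eventually_lt_const (by linarith [a.2.2])
  have key : ∀ᶠ v in 𝓝 w, ∀ i ≤ m, S.phi^[i] v ∈ A i ∩ B i := by
    filter_upwards [ev1, ev2, ev3, ev4, ev5, ev6] with v e1 e2 e3 e4 e5 e6
    have hv : S.bracket (S.bracket v y) (S.bracket z v) = v := by
      have d := e3 0 (Nat.zero_le _)
      simp only [Function.iterate_zero, id] at d
      rw [S.bracket_assoc₂ _ _ _ e4.le (by linarith) e6.le,
        S.bracket_assoc₁ _ _ _ (by rw [dist_comm]; exact e5.le) e6.le (by simpa using he.le),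
        S.bracket_self]
    have := markov_core H1 H2 hMP m A B hA hB h0 hm _ _ e1 e2 e3
    rwa [hv] at this
  intro i hi
  by_contra hne
  have hdis := hMP.2.2.2.1 _ (hA i) _ (hB i) hne
  rw [← interior_inter] at hdis
  have hmem : w ∈ interior ((⇑(S.phi ^ (i : ℤ))) ⁻¹' (A i ∩ B i)) := by
    rw [mem_interior_iff_mem_nhds]
    filter_upwards [key] with v hv
    have := hv i hi
    rw [Equiv.Perm.iterate_eq_pow] at this
    simpa using this
  have := S.mem_interior_zpow _ _ _ hmem
  rw [hdis] at this
  exact this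

theorem allWords_finite {R1 : Set (Set X)} (hfin : R1.Finite) (n : ℕ) :
    {R : Set X | ∃ g : ℤ → Set X, (∀ i : ℤ, g i ∈ R1) ∧
      R = ⋂ i ∈ Finset.Icc (-(n : ℤ)) (n : ℤ), (⇑(S.phi ^ i)) ⁻¹' (g i)}.Finite := by
  have := hfin.to_subtype
  refine (Set.finite_range (fun g : (Finset.Icc (-(n : ℤ)) (n : ℤ)) → R1 =>
    ⋂ i : (Finset.Icc (-(n : ℤ)) (n : ℤ)), (⇑(S.phi ^ (i : ℤ))) ⁻¹' (g i : Set X))).subset ?_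
  rintro R ⟨g, hg, rfl⟩
  refine ⟨fun i => ⟨g i, hg i⟩, ?_⟩
  ext x
  simp

theorem markovSeq_finite {R1 : Set (Set X)} (hfin : R1.Finite) (n : ℕ) :
    (S.markovSeq R1 (n + 1)).Finite :=
  (allWords_finite (S := S) hfin n).subset fun _ hR => hR.2

theorem interior_sUnion_empty {Y : Type*} [TopologicalSpace Y] {F : Set (Set Y)} (hF : F.Finite)
    (hcl : ∀ R ∈ F, IsClosed R) (hi : ∀ R ∈ F, interior R = ∅) : interior (⋃₀ F) = ∅ := by
  induction F, hF using Set.Finite.induction_on with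
  | empty => simp
  | @insert a s _ _ ih =>
    rw [sUnion_insert, interior_union_isClosed_of_interior_empty (hcl a (mem_insert _ _))
      (ih (fun R hR => hcl R (mem_insert_of_mem _ hR)) (fun R hR => hi R (mem_insert_of_mem _ hR)))]
    exact hi a (mem_insert _ _)

theorem markovSeq_cover {ε' : ℝ} {R1 : Set (Set X)} (hMP : S.IsMarkovPartition ε' R1) (n : ℕ)
    (x : X) : ∃ R ∈ S.markovSeq R1 (n + 1), x ∈ R := by
  obtain ⟨hfin, hcov, hR, -, -⟩ := hMP
  set F := {R : Set X | ∃ g : ℤ → Set X, (∀ i : ℤ, g i ∈ R1) ∧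
      R = ⋂ i ∈ Finset.Icc (-(n : ℤ)) (n : ℤ), (⇑(S.phi ^ i)) ⁻¹' (g i)} with hFdef
  have hF : F.Finite := allWords_finite hfin n
  have hcl : ∀ R ∈ F, IsClosed R := by
    rintro R ⟨g, hg, rfl⟩
    exact isClosed_biInter fun i _ => (hR _ (hg i)).2.1.preimage (S.continuous_zpow_phi i)
  have hM : S.markovSeq R1 (n + 1) ⊆ F := fun _ h => h.2
  have hMcl : IsClosed (⋃₀ S.markovSeq R1 (n + 1)) :=
    by
      rw [sUnion_eq_biUnion]
      exact (hF.subset hM).isClosed_biUnion fun R h => hcl R (hM h)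
  have hu : (⋃₀ S.markovSeq R1 (n + 1))ᶜ ⊆ ⋃₀ (F \ S.markovSeq R1 (n + 1)) := by
    intro v hv
    have : ∀ i : ℤ, ∃ A ∈ R1, (S.phi ^ i) v ∈ A := by
      intro i
      have : (S.phi ^ i) v ∈ ⋃₀ R1 := by rw [hcov]; trivial
      exact this
    choose g hg hgv using this
    refine ⟨⋂ i ∈ Finset.Icc (-(n : ℤ)) (n : ℤ), (⇑(S.phi ^ i)) ⁻¹' (g i),
      ⟨⟨g, hg, rfl⟩, fun hc => hv ⟨_, hc, ?_⟩⟩, ?_⟩ <;>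
    exact mem_iInter₂.2 fun i _ => hgv i
  have hemp : interior (⋃₀ (F \ S.markovSeq R1 (n + 1))) = ∅ := by
    refine interior_sUnion_empty (hF.subset sdiff_subset) (fun R h => hcl R h.1) fun R h => ?_
    by_contra hc
    exact h.2 ⟨nonempty_iff_ne_empty.2 hc, h.1⟩
  have : (⋃₀ S.markovSeq R1 (n + 1))ᶜ = ∅ := by
    have := interior_maximal hu hMcl.isOpen_compl
    rw [hemp] at this
    exact subset_empty_iff.1 this
  have hx : x ∈ ⋃₀ S.markovSeq R1 (n + 1) := by
    rw [compl_empty_iff.1 this]; trivial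
  exact hx

theorem markovSeq_card_le {ε' ε'' : ℝ} (hε' : S.epsOne ε') (hε'' : S.epsTwo ε' ε'')
    {R1 : Set (Set X)} (hMP : S.IsMarkovPartition ε' R1) [Nonempty X] (n : ℕ) (s : Finset X)
    (hs : Dynamics.IsDynCoverOf ⇑S.phi Set.univ {p : X × X | dist p.1 p.2 < ε'' / 2}
      (2 * n + 1) s) :
    (S.markovSeq R1 (n + 1)).ncard ≤ R1.ncard * R1.ncard * s.card := by
  have hfin := hMP.1
  have hc : ∀ x : X, ∃ y ∈ s, ∀ j < 2 * n + 1, dist (S.phi^[j] x) (S.phi^[j] y) < ε'' / 2 := by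
    intro x
    obtain ⟨y, hy, hxy⟩ := hs (mem_univ x)
    exact ⟨y, hy, Dynamics.mem_dynEntourage.1 hxy⟩
  choose c hcs hcd using hc
  have hw : ∀ R ∈ S.markovSeq R1 (n + 1), ∃ (g : ℤ → Set X) (y : X),
      y ∈ interior R ∧ (∀ i, g i ∈ R1) ∧
      R = ⋂ i ∈ Finset.Icc (-(n : ℤ)) (n : ℤ), (⇑(S.phi ^ i)) ⁻¹' (g i) := by
    rintro R ⟨⟨y, hy⟩, g, hg, he⟩
    exact ⟨g, y, hy, hg, he⟩
  choose! g y hgy using hw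
  let f : Set X → (Set X × Set X) × X := fun R =>
    ((g R (-(n : ℤ)), g R n), c ((S.phi ^ (-(n : ℤ))) (y R)))
  have hT : ((R1 ×ˢ R1) ×ˢ (s : Set X)).Finite := (hfin.prod hfin).prod s.finite_toSet
  have hcard : ((R1 ×ˢ R1) ×ˢ (s : Set X)).ncard = R1.ncard * R1.ncard * s.card := by
    rw [Set.ncard_prod, Set.ncard_prod, Set.ncard_coe_finset]
  rw [← hcard]
  refine Set.ncard_le_ncard_of_injOn f ?_ ?_ hT
  · intro R hR
    obtain ⟨-, h2, -⟩ := hgy R hR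
    exact ⟨⟨h2 _, h2 _⟩, hcs _⟩
  · intro R hR R' hR' hff
    obtain ⟨h1, h2, h3⟩ := hgy R hR
    obtain ⟨h1', h2', h3'⟩ := hgy R' hR'
    simp only [f, Prod.mk.injEq] at hff
    obtain ⟨⟨f1, f2⟩, f3⟩ := hff
    have hint : ∀ R ∈ S.markovSeq R1 (n + 1), ∀ i ≤ 2 * n,
        S.phi^[i] ((S.phi ^ (-(n : ℤ))) (y R)) ∈ interior (g R ((i : ℤ) + -(n : ℤ))) := by
      intro R hR i hi
      obtain ⟨h1, h2, h3⟩ := hgy R hR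
      rw [S.iterate_apply_zpow]
      apply S.mem_interior_zpow
      refine interior_mono (h3.subset.trans ?_) h1
      exact biInter_subset_of_mem (Finset.mem_coe.2 (Finset.mem_Icc.2 ⟨by omega, by omega⟩))
    have := markov_words_eq hε' hε'' hMP (2 * n) (fun i => g R ((i : ℤ) + -(n : ℤ)))
      (fun i => g R' ((i : ℤ) + -(n : ℤ))) (fun i => h2 _) (fun i => h2' _)
      (by simpa using f1) (by
        have : ((2 * n : ℕ) : ℤ) + -(n : ℤ) = n := by push_cast; ring
        simp only [this]; exact f2)
      ((S.phi ^ (-(n : ℤ))) (y R)) ((S.phi ^ (-(n : ℤ))) (y R'))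
      (hint R hR) (hint R' hR') (by
        intro i hi
        have d1 := hcd ((S.phi ^ (-(n : ℤ))) (y R)) i (by omega)
        have d2 := hcd ((S.phi ^ (-(n : ℤ))) (y R')) i (by omega)
        rw [f3] at d1
        have := dist_triangle_right (S.phi^[i] ((S.phi ^ (-(n : ℤ))) (y R)))
          (S.phi^[i] ((S.phi ^ (-(n : ℤ))) (y R')))
          (S.phi^[i] (c ((S.phi ^ (-(n : ℤ))) (y R'))))
        linarith)
    rw [h3, h3']
    refine iInter₂_congr fun i hi => ?_
    have hi' := Finset.mem_Icc.1 hi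
    have e := this (i + n).toNat (by omega)
    have e2 : (((i + n).toNat : ℤ)) + -(n : ℤ) = i := by omega
    simp only [e2] at e
    rw [e]

theorem coverMincard_le_markovSeq [CompactSpace X] [Nonempty X] {ε' ε'' : ℝ}
    {R1 : Set (Set X)} (hMP : S.IsMarkovPartition ε' R1) (hdiam : ∀ R ∈ R1, diam R ≤ ε'')
    (U : Set (X × X)) (k : ℕ)
    (hk : ∀ x y : X, (∀ i : ℤ, |i| ≤ k → dist ((S.phi ^ i) x) ((S.phi ^ i) y) ≤ ε'') →
      (x, y) ∈ U) (m : ℕ) :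
    Dynamics.coverMincard ⇑S.phi Set.univ U (2 * m + 1) ≤
      ((S.markovSeq R1 (m + k + 1)).ncard : ℕ∞) := by
  classical
  have hfin := markovSeq_finite (S := S) hMP.1 (m + k)
  have hpt : ∀ R ∈ S.markovSeq R1 (m + k + 1), ∃ p, p ∈ R := fun R hR =>
    ⟨_, interior_subset hR.1.some_mem⟩
  choose! p hp using hpt
  let s : Finset X := hfin.toFinset.image fun R => (S.phi ^ (-(m : ℤ))) (p R)
  have hs : Dynamics.IsDynCoverOf ⇑S.phi Set.univ U (2 * m + 1) s := by
    intro x _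
    obtain ⟨R, hR, hxR⟩ := markovSeq_cover hMP (m + k) ((S.phi ^ (m : ℤ)) x)
    refine ⟨(S.phi ^ (-(m : ℤ))) (p R), ?_, ?_⟩
    · simp only [s, Finset.coe_image, Set.Finite.coe_toFinset]
      exact ⟨R, hR, rfl⟩
    · refine Dynamics.mem_dynEntourage.2 fun j hj => ?_
      have hxx : x = (S.phi ^ (-(m : ℤ))) ((S.phi ^ (m : ℤ)) x) := by
        rw [S.zpow_add_apply]; simp
      rw [hxx, S.iterate_apply_zpow, S.iterate_apply_zpow]
      refine hk _ _ fun i hi => ?_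
      rw [S.zpow_add_apply i _ ((S.phi ^ (m : ℤ)) x), S.zpow_add_apply i _ (p R)]
      have hpR := hp R hR
      obtain ⟨-, g, hg, he⟩ := hR
      replace hxR := he.subset hxR
      replace hpR := he.subset hpR
      have hi2 := abs_le.1 hi
      have hmem : i + ((j : ℤ) + -(m : ℤ)) ∈
          Finset.Icc (-((m + k : ℕ) : ℤ)) ((m + k : ℕ) : ℤ) := by
        rw [Finset.mem_Icc]; push_cast; omega
      exact (dist_le_diam_of_mem (isCompact_univ.isBounded.subset (subset_univ _))
        (s := g (i + ((j : ℤ) + -(m : ℤ))))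
        (mem_iInter₂.1 hxR _ hmem) (mem_iInter₂.1 hpR _ hmem)).trans (hdiam _ (hg _))
  refine hs.coverMincard_le_card.trans ?_
  have : s.card ≤ (S.markovSeq R1 (m + k + 1)).ncard := by
    rw [Set.ncard_eq_toFinset_card _ hfin]
    exact Finset.card_image_le
  exact_mod_cast this

end SmaleSpace

open Set Metric Topology
open scoped ENNReal

/-- Growth rate of the cardinality of the refining sequence of Markov
partitions of an irreducible Smale space: for suitable constants `C, c > 0`,
`c e^{2(h(φ)-ε)n} < #ℛ_n < C e^{2(h(φ)+ε)n}` for all large `n`. -/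
theorem markovSeq_card_growth {X : Type*} [MetricSpace X]
    [CompactSpace X] (S : SmaleSpace X) (ε' ε'' : ℝ)
    (hε' : S.epsOne ε') (hε'' : S.epsTwo ε' ε'')
    (hirr : IrreducibleSystem ⇑S.phi)
    (R1 : Set (Set X)) (hMP : S.IsMarkovPartition ε' R1)
    (hdiam : ∀ R ∈ R1, diam R ≤ ε'')
    (h : ℝ) (hent : Dynamics.coverEntropy ⇑S.phi Set.univ = (h : EReal)) :
    ∃ C c : ℝ, 0 < C ∧ 0 < c ∧ ∀ ε : ℝ, 0 < ε → ε < 1 → ∃ n₀ : ℕ, ∀ n ≥ n₀,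
      c * Real.exp (2 * (h - ε) * n) < ((S.markovSeq R1 n).ncard : ℝ) ∧
      ((S.markovSeq R1 n).ncard : ℝ) < C * Real.exp (2 * (h + ε) * n) := by
  obtain ⟨k1, k2, k3⟩ := id hε''
  have hX : Nonempty X := by
    by_contra hc
    have := not_nonempty_iff.1 hc
    rw [Set.univ_eq_empty_iff.2 this, Dynamics.coverEntropy_empty] at hent
    exact EReal.coe_ne_bot h hent.symm
  have hh : 0 ≤ h := by
    have := Dynamics.coverEntropy_nonneg ⇑S.phi (Set.univ_nonempty (α := X))
    rw [hent] at this
    exact_mod_cast this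
  refine ⟨(R1.ncard * R1.ncard : ℝ) + 1, 1, by positivity, one_pos, fun ε hε _ => ?_⟩
  -- upper bound
  have hU : {p : X × X | dist p.1 p.2 < ε'' / 2} ∈ uniformity X :=
    Metric.dist_mem_uniformity (by linarith)
  have up : Dynamics.coverEntropyEntourage ⇑S.phi Set.univ
      {p : X × X | dist p.1 p.2 < ε'' / 2} < ((h + ε / 2 : ℝ) : EReal) := by
    refine (Dynamics.coverEntropyEntourage_le_coverEntropy ⇑S.phi Set.univ hU).trans_lt ?_
    rw [hent]
    exact_mod_cast (by linarith : h < h + ε / 2)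
  obtain ⟨a, ha⟩ := Filter.eventually_atTop.1 (ExpGrowth.eventually_le_exp up)
  -- lower bound
  have lo : ((h - ε / 2 : ℝ) : EReal) < Dynamics.coverEntropyInf ⇑S.phi Set.univ := by
    rw [Dynamics.coverEntropyInf_eq_coverEntropy _ (Set.mapsTo_univ _ _), hent]
    exact_mod_cast (by linarith : h - ε / 2 < h)
  rw [Dynamics.coverEntropyInf] at lo
  simp only [lt_iSup_iff] at lo
  obtain ⟨U, hU2, lo⟩ := lo
  obtain ⟨b, hb⟩ := Filter.eventually_atTop.1 (ExpGrowth.eventually_exp_le lo)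
  obtain ⟨k, hk⟩ := SmaleSpace.expansive_unif hε' hε'' U hU2
  obtain ⟨q, hq⟩ := exists_nat_gt (h * (2 * k + 1) / ε)
  refine ⟨a + b + k + q + 1, fun n hn => ?_⟩
  obtain ⟨m, rfl⟩ : ∃ m, n = m + k + 1 := ⟨n - k - 1, by omega⟩
  constructor
  · have h1 := hb (2 * m + 1) (by omega)
    have h2 := SmaleSpace.coverMincard_le_markovSeq hMP hdiam U k hk m
    have h3 : EReal.exp (((h - ε / 2 : ℝ) : EReal) * ((2 * m + 1 : ℕ) : EReal)) ≤
        ((S.markovSeq R1 (m + k + 1)).ncard : ℝ≥0∞) := by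
      refine h1.trans ?_
      exact_mod_cast ENat.toENNReal_mono h2
    have h4 : (((h - ε / 2 : ℝ) : EReal) * ((2 * m + 1 : ℕ) : EReal)) =
        (((h - ε / 2) * ((2 * m + 1 : ℕ) : ℝ) : ℝ) : EReal) := by
      rw [EReal.coe_mul]; rfl
    rw [h4, EReal.exp_coe, ← ENNReal.ofReal_natCast,
      ENNReal.ofReal_le_ofReal_iff (Nat.cast_nonneg _)] at h3
    refine lt_of_lt_of_le ?_ h3
    rw [one_mul, Real.exp_lt_exp]
    have hnq : (q : ℝ) < ((m + k + 1 : ℕ) : ℝ) := by exact_mod_cast (by omega)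
    have h5 : h * (2 * k + 1) < ε * ((m + k + 1 : ℕ) : ℝ) := by
      have := hq.trans hnq
      rw [div_lt_iff₀ hε] at this
      linarith
    push_cast at h5 ⊢
    nlinarith [(Nat.cast_nonneg k : (0 : ℝ) ≤ k)]
  · have h1 := ha (2 * (m + k) + 1) (by omega)
    obtain ⟨s, hs, hsc⟩ := (Dynamics.coverMincard_finite_iff _ _ _ _).1
      (Dynamics.coverMincard_finite_of_isCompact_invariant (isCompact_univ (X := X))
        (Set.mapsTo_univ ⇑S.phi _) hU (2 * (m + k) + 1))
    have h2 := SmaleSpace.markovSeq_card_le hε' hε'' hMP (m + k) s hs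
    rw [← hsc] at h1
    have h4 : (((h + ε / 2 : ℝ) : EReal) * ((2 * (m + k) + 1 : ℕ) : EReal)) =
        (((h + ε / 2) * ((2 * (m + k) + 1 : ℕ) : ℝ) : ℝ) : EReal) := by
      rw [EReal.coe_mul]; rfl
    have h3 : (s.card : ℝ) ≤ Real.exp ((h + ε / 2) * ((2 * (m + k) + 1 : ℕ) : ℝ)) := by
      rw [h4, EReal.exp_coe, ENat.toENNReal_coe, ← ENNReal.ofReal_natCast,
        ENNReal.ofReal_le_ofReal_iff (Real.exp_pos _).le] at h1
      exact h1
    have h5 : Real.exp ((h + ε / 2) * ((2 * (m + k) + 1 : ℕ) : ℝ)) ≤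
        Real.exp (2 * (h + ε) * ((m + k + 1 : ℕ) : ℝ)) := by
      rw [Real.exp_le_exp]
      push_cast
      nlinarith [(Nat.cast_nonneg k : (0 : ℝ) ≤ k), (Nat.cast_nonneg m : (0 : ℝ) ≤ m)]
    have h6 : ((S.markovSeq R1 (m + k + 1)).ncard : ℝ) ≤ R1.ncard * R1.ncard * s.card := by
      exact_mod_cast h2
    have h7 := mul_le_mul_of_nonneg_left (h3.trans h5)
      (by positivity : (0 : ℝ) ≤ R1.ncard * R1.ncard)
    have h8 := Real.exp_pos (2 * (h + ε) * ((m + k + 1 : ℕ) : ℝ))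
    linarith
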